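/- arXiv:0902.4132 — 2 statements merged into one kernel-verified Lean document; each statement's English description precedes it below -/
import Mathlib

section
/- Let α be a finite type with at least 3 elements, and let A and B be nonempty sets of transpositions in the symmetric group Perm(α) such that every element of A commutes with every element of B. Then the subgroup of Perm(α) generated by A ∪ B is a proper subgroup, i.e., it is not all of Perm(α). (This is the group-theoretic core of Proposition 2.2 of the paper: the elements of two nontrivial subgroups of the symmetric group S_m, each generated by transpositions and commuting with each other elementwise, cannot generate S_m; it is used to prove that the branch curve of a generic covering of the plane by a smooth irreducible surface of degree ≥ 2 is irreducible.) -/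
/-- The group-theoretic core of Proposition 2.2: if `A` and `B` are nonempty sets of
transpositions in the symmetric group of a finite type `α` with at least 3 elements, and
every element of `A` commutes with every element of `B`, then `A ∪ B` generates a proper
subgroup of the symmetric group. -/
theorem closure_union_commuting_swaps_ne_top {α : Type*} [Fintype α] [DecidableEq α]
    (h3 : 3 ≤ Fintype.card α) (A B : Set (Equiv.Perm α))
    (hA : A.Nonempty) (hB : B.Nonempty)
    (hAswap : ∀ a ∈ A, Equiv.Perm.IsSwap a) (hBswap : ∀ b ∈ B, Equiv.Perm.IsSwap b)
    (hcomm : ∀ a ∈ A, ∀ b ∈ B, Commute a b) :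
    Subgroup.closure (A ∪ B) ≠ ⊤ := by
  intro htop
  obtain ⟨a, ha⟩ := hA
  obtain ⟨b, hb⟩ := hB
  have hcent : Subgroup.closure A ≤ Subgroup.centralizer B := by
    rw [Subgroup.closure_le]
    intro c hc
    rw [SetLike.mem_coe, Subgroup.mem_centralizer_iff]
    intro d hd
    exact (hcomm c hc d hd).symm.eq
  have hnorm : Subgroup.closure (A ∪ B) ≤
      Subgroup.normalizer (Subgroup.closure A : Set (Equiv.Perm α)) := by
    rw [Subgroup.closure_le]
    rintro c (hc | hc)
    · exact Subgroup.le_normalizer (Subgroup.subset_closure hc)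
    · rw [SetLike.mem_coe, Subgroup.mem_normalizer_iff]
      have key : ∀ h ∈ Subgroup.closure A, c * h * c⁻¹ = h := fun h hh => by
        have := Subgroup.mem_centralizer_iff.1 (hcent hh) c hc
        rw [this, mul_inv_cancel_right]
      have key' : ∀ h ∈ Subgroup.closure A, c⁻¹ * h * c = h := fun h hh => by
        have := Subgroup.mem_centralizer_iff.1 (hcent hh) c hc
        rw [mul_assoc, ← this, inv_mul_cancel_left]
      intro h
      constructor
      · intro hh
        simpa [key h hh] using hh
      · intro hh
        have h2 := key' _ hh
        have h3 : h = c * h * c⁻¹ := by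
          rw [← h2]; group
        rw [h3]; exact hh
  obtain ⟨x, y, hxy, rfl⟩ := hBswap b hb
  obtain ⟨u, v, huv, rfl⟩ := hAswap a ha
  obtain ⟨z, hz⟩ : ∃ z, z ∉ ({x, y} : Finset α) := by
    by_contra! hall
    have h1 := Finset.card_le_card (fun w _ => hall w : Finset.univ ⊆ ({x, y} : Finset α))
    have h2 := Finset.card_le_two (a := x) (b := y)
    rw [Finset.card_univ] at h1
    omega
  simp only [Finset.mem_insert, Finset.mem_singleton, not_or] at hz
  obtain ⟨g, hg⟩ := isConj_iff.1 (Equiv.Perm.isConj_swap huv (Ne.symm hz.2))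
  have hgm := hnorm (htop ▸ Subgroup.mem_top g)
  have hm := (Subgroup.mem_normalizer_iff.1 hgm _).1 (Subgroup.subset_closure ha)
  rw [hg] at hm
  have hc := Subgroup.mem_centralizer_iff.1 (hcent hm) _ hb
  have hx := congrArg (fun f : Equiv.Perm α => f x) hc
  simp only [Equiv.Perm.mul_apply] at hx
  rw [Equiv.swap_apply_of_ne_of_ne hxy (Ne.symm hz.1), Equiv.swap_apply_left,
    Equiv.swap_apply_left] at hx
  exact hz.2 hx.symm
end

section
/- Let F₁, F₂, K₁, K₂ be polynomials in ℂ[x₁,x₂,x₃,x₄] and set F = K₁·F₁ + K₂·F₂. Let Z = {p ∈ ℂ⁴ : p ≠ 0, F₁(p) = F₂(p) = 0}. Assume that (a) for every p ∈ Z the gradient vectors ∇F₁(p) and ∇F₂(p) in ℂ⁴ are linearly independent over ℂ and all four partial derivatives of F vanish at p, and (b) every polynomial in ℂ[x₁,x₂,x₃,x₄] vanishing at every point of Z belongs to the ideal generated by F₁ and F₂. Then there exist polynomials A, B, C in ℂ[x₁,x₂,x₃,x₄] such that F = A·F₁² + B·F₁·F₂ + C·F₂². (This is the first part of Proposition 6.1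 of the paper: if a surface Y ⊂ ℙ³ with ordinary singularities given by F = 0 has smooth double curve D = {F₁ = F₂ = 0} which is a complete intersection, then F can be written in the form A F₁² + B F₁ F₂ + C F₂².) -/
open MvPolynomial

/-- The gradient of a polynomial in four variables at a point: the vector of its four
partial derivatives evaluated at the point. -/
noncomputable def polyGrad (G : MvPolynomial (Fin 4) ℂ) (p : Fin 4 → ℂ) : Fin 4 → ℂ :=
  fun i => eval p (pderiv i G)

/-- The first part of Proposition 6.1: if `F = K₁F₁ + K₂F₂`, the gradients of `F₁`, `F₂`
are linearly independent at every point of `Z = {p ≠ 0 | F₁(p) = F₂(p) = 0}`, all partial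
derivatives of `F` vanish on `Z`, and every polynomial vanishing on `Z` lies in the ideal
`(F₁, F₂)`, then `F = A F₁² + B F₁ F₂ + C F₂²` for some polynomials `A`, `B`, `C`. -/
theorem exists_ABC_of_double_curve (F₁ F₂ K₁ K₂ F : MvPolynomial (Fin 4) ℂ)
    (hF : F = K₁ * F₁ + K₂ * F₂)
    (Z : Set (Fin 4 → ℂ))
    (hZ : Z = {p : Fin 4 → ℂ | p ≠ 0 ∧ eval p F₁ = 0 ∧ eval p F₂ = 0})
    (ha : ∀ p ∈ Z, LinearIndependent ℂ ![polyGrad F₁ p, polyGrad F₂ p] ∧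
      ∀ i : Fin 4, eval p (pderiv i F) = 0)
    (hb : ∀ G : MvPolynomial (Fin 4) ℂ, (∀ p ∈ Z, eval p G = 0) →
      G ∈ Ideal.span ({F₁, F₂} : Set (MvPolynomial (Fin 4) ℂ))) :
    ∃ A B C : MvPolynomial (Fin 4) ℂ, F = A * F₁ ^ 2 + B * F₁ * F₂ + C * F₂ ^ 2 := by
  have key : ∀ p ∈ Z, eval p K₁ = 0 ∧ eval p K₂ = 0 := by
    intro p hp
    obtain ⟨hli, hd⟩ := ha p hp
    have hp' := hp
    rw [hZ] at hp'
    obtain ⟨_, h1, h2⟩ := hp'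
    refine LinearIndependent.pair_iff.mp hli _ _ ?_
    funext i
    have h := hd i
    rw [hF] at h
    simp only [map_add, Derivation.leibniz, smul_eq_mul, map_mul, h1, h2, zero_mul,
      add_zero] at h
    simpa [polyGrad] using h
  obtain ⟨a, b, h1⟩ := Ideal.mem_span_pair.mp (hb K₁ fun p hp => (key p hp).1)
  obtain ⟨c, d, h2⟩ := Ideal.mem_span_pair.mp (hb K₂ fun p hp => (key p hp).2)
  refine ⟨a, b + c, d, ?_⟩
  rw [hF, ← h1, ← h2]
  ring
end
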